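/- arXiv:0708.4019 — 4 statements merged into one kernel-verified Lean document; each statement's English description precedes it below -/
import Mathlib

section
/- Let n, r be positive natural numbers, let λ be a partition of r with at most n parts, and let m be a natural number with m ≥ λ₁. Then the number of semistandard λ-tableaux with entries in {1,…,n} equals the number of semistandard T_m(λ)-tableaux with entries in {1,…,n}. -/
/-- The complement of a partition `lam` (given as a weakly decreasing function `Fin n → ℕ`)
inside an `n × m` rectangle: `T_m(lam) = (m - lam_n, m - lam_{n-1}, …, m - lam_1)`. -/
def complementPartition (n m : ℕ) (lam : Fin n → ℕ) : Fin n → ℕ :=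
  fun i => m - lam i.rev

/-- `S : Fin n → Fin m → ℕ` represents a semistandard tableau of shape `lam`
(a partition with at most `n` parts, each part of size at most `m`) with entries
in `{1,…,n}`: on the cells of the diagram of `lam` the entries lie in `{1,…,n}`,
weakly increase along rows and strictly increase down columns; outside the diagram
`S` is `0` (a padding value). -/
def IsSemistandardOfShape (n m : ℕ) (lam : Fin n → ℕ) (S : Fin n → Fin m → ℕ) : Prop :=
  (∀ (i : Fin n) (j : Fin m), (j : ℕ) < lam i → S i j ∈ Finset.Icc 1 n) ∧
  (∀ (i : Fin n) (j : Fin m), lam i ≤ (j : ℕ) → S i j = 0) ∧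
  (∀ (i : Fin n) (j j' : Fin m), j ≤ j' → (j' : ℕ) < lam i → S i j ≤ S i j') ∧
  (∀ (i i' : Fin n) (j : Fin m), i < i' → (j : ℕ) < lam i' → S i j < S i' j)

namespace SSComp

/-- The set of entries in column `j`. -/
def col (n m : ℕ) (lam : Fin n → ℕ) (S : Fin n → Fin m → ℕ) (j : Fin m) : Finset ℕ :=
  (Finset.univ.filter (fun i => (j : ℕ) < lam i)).image (fun i => S i j)

lemma lt_height {n : ℕ} {lam : Fin n → ℕ} (h : Antitone lam) (j : ℕ) (i : Fin n) :
    (i : ℕ) < (Finset.univ.filter (fun i => j < lam i)).card ↔ j < lam i := by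
  constructor
  · intro hi
    by_contra hc
    have : Finset.univ.filter (fun i => j < lam i) ⊆ Finset.Iio i := by
      intro k hk
      simp only [Finset.mem_filter, Finset.mem_univ, true_and] at hk
      rw [Finset.mem_Iio]
      by_contra hki
      have := h (not_lt.mp hki)
      omega
    have := Finset.card_le_card this
    rw [Fin.card_Iio] at this
    omega
  · intro hj
    have : Finset.Iic i ⊆ Finset.univ.filter (fun i => j < lam i) := by
      intro k hk
      have := h (Finset.mem_Iic.mp hk)
      simp only [Finset.mem_filter, Finset.mem_univ, true_and]
      omega
    have := Finset.card_le_card this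
    rw [Fin.card_Iic] at this
    omega

lemma injOn_col {n m : ℕ} {lam : Fin n → ℕ} {S : Fin n → Fin m → ℕ}
    (hS : IsSemistandardOfShape n m lam S) (j : Fin m) :
    Set.InjOn (fun i => S i j) {i | (j : ℕ) < lam i} := by
  intro a ha b hb hab
  rcases lt_trichotomy a b with h | h | h
  · have := hS.2.2.2 a b j h hb
    simp only at hab
    omega
  · exact h
  · have := hS.2.2.2 b a j h ha
    simp only at hab
    omega

lemma card_col {n m : ℕ} {lam : Fin n → ℕ} {S : Fin n → Fin m → ℕ}
    (hS : IsSemistandardOfShape n m lam S) (j : Fin m) :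
    (col n m lam S j).card = (Finset.univ.filter (fun i => (j : ℕ) < lam i)).card := by
  apply Finset.card_image_of_injOn
  simpa using injOn_col hS j

lemma count_col {n m : ℕ} {lam : Fin n → ℕ} {S : Fin n → Fin m → ℕ}
    (hS : IsSemistandardOfShape n m lam S) (j : Fin m) (x : ℕ) :
    Nat.count (· ∈ col n m lam S j) x
      = (Finset.univ.filter (fun i => (j : ℕ) < lam i ∧ S i j < x)).card := by
  rw [Nat.count_eq_card_filter_range]
  have : (Finset.range x).filter (· ∈ col n m lam S j)
      = (Finset.univ.filter (fun i => (j : ℕ) < lam i ∧ S i j < x)).image (fun i => S i j) := by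
    ext v
    simp only [col, Finset.mem_filter, Finset.mem_range, Finset.mem_image, Finset.mem_univ,
      true_and]
    constructor
    · rintro ⟨h, i, hi, rfl⟩
      exact ⟨i, ⟨hi, h⟩, rfl⟩
    · rintro ⟨i, ⟨hi, h⟩, rfl⟩
      exact ⟨h, i, hi, rfl⟩
  rw [this]
  apply Finset.card_image_of_injOn
  apply (injOn_col hS j).mono
  intro i hi
  simp at hi
  exact hi.1

lemma eq_nth {n m : ℕ} {lam : Fin n → ℕ} (hl : Antitone lam) {S : Fin n → Fin m → ℕ}
    (hS : IsSemistandardOfShape n m lam S) (i : Fin n) (j : Fin m) (h : (j : ℕ) < lam i) :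
    S i j = Nat.nth (· ∈ col n m lam S j) i := by
  have hmem : S i j ∈ col n m lam S j :=
    Finset.mem_image.mpr ⟨i, by simpa using h, rfl⟩
  have h1 : Nat.count (· ∈ col n m lam S j) (S i j) = i := by
    rw [count_col hS]
    have : (Finset.univ.filter (fun k => (j : ℕ) < lam k ∧ S k j < S i j)) = Finset.Iio i := by
      ext k
      simp only [Finset.mem_filter, Finset.mem_univ, true_and, Finset.mem_Iio]
      constructor
      · rintro ⟨hk, hlt⟩
        by_contra hc
        rcases (not_lt.mp hc).eq_or_lt with e | e
        · subst e; omega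
        · have := hS.2.2.2 i k j e hk
          omega
      · intro hk
        exact ⟨lt_of_lt_of_le h (hl hk.le), hS.2.2.2 k i j hk h⟩
    rw [this, Fin.card_Iio]
  have h2 := Nat.nth_count (p := (· ∈ col n m lam S j)) hmem
  rw [h1] at h2
  exact h2.symm

lemma count_anti {n m : ℕ} {lam : Fin n → ℕ} {S : Fin n → Fin m → ℕ}
    (hS : IsSemistandardOfShape n m lam S) (j j' : Fin m) (h : j ≤ j') (x : ℕ) :
    Nat.count (· ∈ col n m lam S j') x ≤ Nat.count (· ∈ col n m lam S j) x := by
  rw [count_col hS, count_col hS]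
  apply Finset.card_le_card
  intro i hi
  simp only [Finset.mem_filter, Finset.mem_univ, true_and] at hi ⊢
  have := hS.2.2.1 i j j' h hi.1
  have h' : (j : ℕ) ≤ j' := h
  omega

lemma col_subset {n m : ℕ} {lam : Fin n → ℕ} {S : Fin n → Fin m → ℕ}
    (hS : IsSemistandardOfShape n m lam S) (j : Fin m) :
    col n m lam S j ⊆ Finset.Icc 1 n := by
  intro v hv
  simp only [col, Finset.mem_filter, Finset.mem_image, Finset.mem_univ, true_and] at hv
  obtain ⟨i, hi, rfl⟩ := hv
  exact hS.1 i j hi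

/-- The complement of column `j` of `S`. -/
def ccol (n m : ℕ) (lam : Fin n → ℕ) (S : Fin n → Fin m → ℕ) (j : Fin m) : Finset ℕ :=
  Finset.Icc 1 n \ col n m lam S j.rev

lemma count_sdiff (A B : Finset ℕ) (h : A ⊆ B) (x : ℕ) :
    Nat.count (· ∈ B \ A) x + Nat.count (· ∈ A) x = Nat.count (· ∈ B) x := by
  induction x with
  | zero => simp
  | succ x ih =>
    have := @h x
    simp only [Nat.count_succ, Finset.mem_sdiff] at ih ⊢
    by_cases h1 : x ∈ A <;> by_cases h2 : x ∈ B <;> simp [h1, h2] <;> first | omega | tauto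

lemma count_ccol {n m : ℕ} {lam : Fin n → ℕ} {S : Fin n → Fin m → ℕ}
    (hS : IsSemistandardOfShape n m lam S) (j j' : Fin m) (h : j ≤ j') (x : ℕ) :
    Nat.count (· ∈ ccol n m lam S j') x ≤ Nat.count (· ∈ ccol n m lam S j) x := by
  have h1 := count_sdiff _ _ (col_subset hS j.rev) x
  have h2 := count_sdiff _ _ (col_subset hS j'.rev) x
  have h3 := count_anti hS j'.rev j.rev (Fin.rev_le_rev.mpr h) x
  unfold ccol
  omega

lemma anti_compl {n m : ℕ} {lam : Fin n → ℕ} (hl : Antitone lam) :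
    Antitone (complementPartition n m lam) := by
  intro a b hab
  have := hl (Fin.rev_le_rev.mpr hab)
  simp only [complementPartition]
  omega

lemma card_ccol {n m : ℕ} {lam : Fin n → ℕ} {S : Fin n → Fin m → ℕ}
    (hS : IsSemistandardOfShape n m lam S) (j : Fin m) :
    (ccol n m lam S j).card
      = (Finset.univ.filter (fun i => (j : ℕ) < complementPartition n m lam i)).card := by
  unfold ccol
  rw [Finset.card_sdiff_of_subset (col_subset hS _), card_col hS]
  have e : (Finset.univ.filter (fun i => (j : ℕ) < complementPartition n m lam i)).card
      = (Finset.univ.filter (fun i => ¬ (j.rev : ℕ) < lam i)).card := by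
    apply Finset.card_bij (fun i _ => i.rev)
    · intro i hi
      have h1 : (j : ℕ) < m - lam i.rev := (Finset.mem_filter.mp hi).2
      refine Finset.mem_filter.mpr ⟨Finset.mem_univ _, ?_⟩
      rw [Fin.val_rev]
      omega
    · intro a _ b _ hab
      exact Fin.rev_injective hab
    · intro b hb
      refine ⟨b.rev, ?_, Fin.rev_rev b⟩
      have h1 := (Finset.mem_filter.mp hb).2
      refine Finset.mem_filter.mpr ⟨Finset.mem_univ _, ?_⟩
      rw [Fin.val_rev] at h1
      have h2 : complementPartition n m lam b.rev = m - lam b := by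
        simp only [complementPartition, Fin.rev_rev]
      omega
  have := Finset.card_filter_add_card_filter_not (s := (Finset.univ : Finset (Fin n)))
    (fun i => (j.rev : ℕ) < lam i)
  simp only [Finset.card_univ, Fintype.card_fin] at this
  rw [e, Nat.card_Icc]
  omega

/-- The complementary tableau. -/
noncomputable def Phi (n m : ℕ) (lam : Fin n → ℕ) (S : Fin n → Fin m → ℕ) :
    Fin n → Fin m → ℕ :=
  fun i j => if (j : ℕ) < complementPartition n m lam i then
    Nat.nth (· ∈ ccol n m lam S j) i else 0

lemma fin_aux {B : Finset ℕ} {k : ℕ} (h : k < B.card) :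
    ∀ hf : (Set.ofPred (· ∈ B)).Finite, k < hf.toFinset.card := by
  intro hf
  have : hf.toFinset = B := by ext; simp [Set.Finite.mem_toFinset]
  rwa [this]

lemma lt_ccol {n m : ℕ} {lam : Fin n → ℕ} (hl : Antitone lam) {S : Fin n → Fin m → ℕ}
    (hS : IsSemistandardOfShape n m lam S) (i : Fin n) (j : Fin m)
    (h : (j : ℕ) < complementPartition n m lam i) : (i : ℕ) < (ccol n m lam S j).card := by
  rw [card_ccol hS, lt_height (anti_compl hl)]
  exact h

lemma Phi_mem {n m : ℕ} {lam : Fin n → ℕ} (hl : Antitone lam) {S : Fin n → Fin m → ℕ}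
    (hS : IsSemistandardOfShape n m lam S) (i : Fin n) (j : Fin m)
    (h : (j : ℕ) < complementPartition n m lam i) : Phi n m lam S i j ∈ ccol n m lam S j := by
  simp only [Phi, if_pos h]
  exact Nat.nth_mem (p := (· ∈ ccol n m lam S j)) i (fin_aux (lt_ccol hl hS i j h))

lemma Phi_ss {n m : ℕ} {lam : Fin n → ℕ} (hl : Antitone lam) {S : Fin n → Fin m → ℕ}
    (hS : IsSemistandardOfShape n m lam S) :
    IsSemistandardOfShape n m (complementPartition n m lam) (Phi n m lam S) := by
  refine ⟨?_, ?_, ?_, ?_⟩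
  · intro i j h
    exact (Finset.mem_sdiff.mp (Phi_mem hl hS i j h)).1
  · intro i j h
    simp only [Phi, if_neg (not_lt.mpr h)]
  · intro i j j' hjj h
    have hj : (j : ℕ) < complementPartition n m lam i := lt_of_le_of_lt hjj h
    have hlt := lt_ccol hl hS i j' h
    have hm := Phi_mem hl hS i j' h
    simp only [Phi, if_pos h, if_pos hj] at hm ⊢
    have hc := Nat.count_nth (p := (· ∈ ccol n m lam S j')) (fin_aux hlt)
    have hle := count_ccol hS j j' hjj (Nat.nth (· ∈ ccol n m lam S j') i + 1)
    rw [Nat.count_succ, hc, if_pos hm] at hle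
    have := Nat.nth_lt_of_lt_count (p := (· ∈ ccol n m lam S j)) hle
    omega
  · intro i i' j hii h
    have hi : (j : ℕ) < complementPartition n m lam i := lt_of_lt_of_le h (anti_compl hl hii.le)
    simp only [Phi, if_pos h, if_pos hi]
    exact Nat.nth_lt_nth' (p := (· ∈ ccol n m lam S j)) hii (fin_aux (lt_ccol hl hS i' j h))

lemma col_Phi {n m : ℕ} {lam : Fin n → ℕ} (hl : Antitone lam) {S : Fin n → Fin m → ℕ}
    (hS : IsSemistandardOfShape n m lam S) (j : Fin m) :
    col n m (complementPartition n m lam) (Phi n m lam S) j = ccol n m lam S j := by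
  apply Finset.eq_of_subset_of_card_le
  · intro v hv
    simp only [col, Finset.mem_filter, Finset.mem_image, Finset.mem_univ, true_and] at hv
    obtain ⟨i, hi, rfl⟩ := hv
    exact Phi_mem hl hS i j hi
  · rw [card_ccol hS, card_col (Phi_ss hl hS)]

lemma Phi_inj {n m : ℕ} {lam : Fin n → ℕ} (hl : Antitone lam) {S T : Fin n → Fin m → ℕ}
    (hS : IsSemistandardOfShape n m lam S) (hT : IsSemistandardOfShape n m lam T)
    (h : Phi n m lam S = Phi n m lam T) : S = T := by
  have hcol : ∀ j, col n m lam S j = col n m lam T j := by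
    intro j
    have h1 := col_Phi hl hS j.rev
    rw [h, col_Phi hl hT j.rev] at h1
    simp only [ccol, Fin.rev_rev] at h1
    rw [← Finset.sdiff_sdiff_eq_self (col_subset hS j), ← h1,
      Finset.sdiff_sdiff_eq_self (col_subset hT j)]
  funext i j
  by_cases hij : (j : ℕ) < lam i
  · rw [eq_nth hl hS i j hij, eq_nth hl hT i j hij, hcol]
  · rw [hS.2.1 i j (not_lt.mp hij), hT.2.1 i j (not_lt.mp hij)]

lemma finite_ss (n m : ℕ) (lam : Fin n → ℕ) :
    Finite {S : Fin n → Fin m → ℕ // IsSemistandardOfShape n m lam S} := by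
  have hb : ∀ S : {S : Fin n → Fin m → ℕ // IsSemistandardOfShape n m lam S}, ∀ i j,
      S.1 i j < n + 1 := by
    intro S i j
    by_cases hij : (j : ℕ) < lam i
    · have := Finset.mem_Icc.mp (S.2.1 i j hij)
      omega
    · have := S.2.2.1 i j (not_lt.mp hij)
      omega
  apply Finite.of_injective
    (fun S => (fun i j => ⟨S.1 i j, hb S i j⟩ : Fin n → Fin m → Fin (n + 1)))
  intro S T h
  apply Subtype.ext
  funext i j
  have := congrFun (congrFun h i) j
  simpa using this

lemma card_le {n m : ℕ} {lam : Fin n → ℕ} (hl : Antitone lam) :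
    Nat.card {S : Fin n → Fin m → ℕ // IsSemistandardOfShape n m lam S} ≤
      Nat.card {S : Fin n → Fin m → ℕ //
        IsSemistandardOfShape n m (complementPartition n m lam) S} := by
  have := finite_ss n m (complementPartition n m lam)
  apply Nat.card_le_card_of_injective (fun S => ⟨Phi n m lam S.1, Phi_ss hl S.2⟩)
  intro S T h
  exact Subtype.ext (Phi_inj hl S.2 T.2 (congrArg Subtype.val h))

end SSComp

/-- The number of semistandard tableaux of shape `lam` with entries in `{1,…,n}` equals
the number of semistandard tableaux of the complement shape `T_m(lam)` with entries
in `{1,…,n}`. -/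
theorem card_semistandard_eq_card_semistandard_complement (n r m : ℕ)
    (hn : 0 < n) (hr : 0 < r)
    (lam : Fin n → ℕ) (hanti : Antitone lam) (hsum : ∑ i, lam i = r)
    (hm : lam ⟨0, hn⟩ ≤ m) :
    Nat.card {S : Fin n → Fin m → ℕ // IsSemistandardOfShape n m lam S} =
      Nat.card {S : Fin n → Fin m → ℕ //
        IsSemistandardOfShape n m (complementPartition n m lam) S} := by
  apply le_antisymm (SSComp.card_le hanti)
  have h := SSComp.card_le (m := m) (SSComp.anti_compl (m := m) hanti)
  have e : complementPartition n m (complementPartition n m lam) = lam := by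
    funext i
    have h1 : lam i ≤ lam ⟨0, hn⟩ := hanti (Fin.mk_le_of_le_val (Nat.zero_le _))
    simp only [complementPartition, Fin.rev_rev]
    omega
  rw [e] at h
  exact h
end

section
/- Let n, r, m be positive natural numbers and let Π be a saturated subset of Λ⁺(n,r) such that every λ ∈ Π satisfies λ₁ ≤ m. Then the set Π̂ = { T_m(λ) : λ ∈ Π } is a saturated subset of Λ⁺(n, nm−r). -/
/-- The dominance order: `lam` dominates `mu` iff all partial sums of `lam` are at least
the corresponding partial sums of `mu`. -/
def Dominates (n : ℕ) (lam mu : Fin n → ℕ) : Prop :=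
  ∀ s : ℕ, ∑ i ∈ Finset.univ.filter (fun i : Fin n => (i : ℕ) < s), mu i ≤
    ∑ i ∈ Finset.univ.filter (fun i : Fin n => (i : ℕ) < s), lam i

/-- `Λ⁺(n,r)`: the set of partitions of `r` with at most `n` parts, realised as weakly
decreasing functions `Fin n → ℕ` summing to `r`. -/
def partitionsOf (n r : ℕ) : Set (Fin n → ℕ) :=
  {lam | Antitone lam ∧ ∑ i, lam i = r}

/-- A subset `P` of `Λ⁺(n,r)` is saturated if it contains every partition of `r` (with at
most `n` parts) dominated by some member of `P`. -/
def IsSaturated (n r : ℕ) (P : Set (Fin n → ℕ)) : Prop :=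
  ∀ mu ∈ partitionsOf n r, ∀ lam ∈ P, Dominates n lam mu → mu ∈ P

theorem sum_rev_filter (n : ℕ) (b : Fin n → ℕ) (s : ℕ) :
    ∑ i ∈ Finset.univ.filter (fun i : Fin n => (i : ℕ) < n - s), b i +
      ∑ i ∈ Finset.univ.filter (fun i : Fin n => (i : ℕ) < s), b i.rev = ∑ i, b i := by
  rw [← Finset.sum_filter_add_sum_filter_not Finset.univ (fun i : Fin n => (i : ℕ) < n - s) b]
  congr 1
  refine Finset.sum_bij' (fun i _ => i.rev) (fun i _ => i.rev) ?_ ?_ ?_ ?_ ?_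
  · intro i hi
    simp only [Finset.mem_filter, Finset.mem_univ, true_and, Fin.val_rev] at hi ⊢
    omega
  · intro i hi
    simp only [Finset.mem_filter, Finset.mem_univ, true_and, Fin.val_rev] at hi ⊢
    omega
  · intro i _
    simp
  · intro i _
    simp
  · intro i _
    rfl

theorem sum_compl_filter (n m : ℕ) (b : Fin n → ℕ) (hb : ∀ i, b i ≤ m) (S : Finset (Fin n)) :
    ∑ i ∈ S, complementPartition n m b i + ∑ i ∈ S, b i.rev = ∑ _i ∈ S, m := by
  rw [← Finset.sum_add_distrib]
  refine Finset.sum_congr rfl fun i _ => ?_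
  have := hb i.rev
  simp only [complementPartition]
  omega

theorem sum_compl (n m : ℕ) (b : Fin n → ℕ) (hb : ∀ i, b i ≤ m) :
    ∑ i, complementPartition n m b i + ∑ i, b i = n * m := by
  have h := sum_compl_filter n m b hb Finset.univ
  have h2 : ∑ i : Fin n, b i.rev = ∑ i, b i := Equiv.sum_comp Fin.revPerm b
  rw [h2] at h
  simpa using h

theorem dominates_compl (n m : ℕ) (a b : Fin n → ℕ) (ha : ∀ i, a i ≤ m) (hb : ∀ i, b i ≤ m)
    (hab : ∑ i, a i = ∑ i, b i) (h : Dominates n a b) :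
    Dominates n (complementPartition n m a) (complementPartition n m b) := by
  intro s
  have h1 := sum_compl_filter n m a ha (Finset.univ.filter (fun i : Fin n => (i : ℕ) < s))
  have h2 := sum_compl_filter n m b hb (Finset.univ.filter (fun i : Fin n => (i : ℕ) < s))
  have h3 := sum_rev_filter n a s
  have h4 := sum_rev_filter n b s
  have h5 := h (n - s)
  omega

theorem antitone_compl (n m : ℕ) (a : Fin n → ℕ) (ha : Antitone a) :
    Antitone (complementPartition n m a) := by
  intro i j hij
  exact Nat.sub_le_sub_left (ha (Fin.rev_le_rev.mpr hij)) m

theorem compl_compl_eq (n m : ℕ) (a : Fin n → ℕ) (ha : ∀ i, a i ≤ m) :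
    complementPartition n m (complementPartition n m a) = a := by
  funext i
  have := ha i
  simp only [complementPartition, Fin.rev_rev]
  omega

/-- If `P ⊆ Λ⁺(n,r)` is saturated and all partitions in `P` have first part at most `m`,
then the image of `P` under the complement operation `T_m` is a saturated subset of
`Λ⁺(n, nm - r)`. -/
theorem complement_of_saturated_isSaturated (n r m : ℕ)
    (hn : 0 < n) (hr : 0 < r) (hm : 0 < m)
    (P : Set (Fin n → ℕ)) (hP : P ⊆ partitionsOf n r) (hsat : IsSaturated n r P)
    (hrow : ∀ lam ∈ P, lam ⟨0, hn⟩ ≤ m) :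
    complementPartition n m '' P ⊆ partitionsOf n (n * m - r) ∧
      IsSaturated n (n * m - r) (complementPartition n m '' P) := by
  have hle : ∀ lam ∈ P, ∀ i, lam i ≤ m := fun lam hl i =>
    ((hP hl).1 (Fin.mk_le_of_le_val (Nat.zero_le _))).trans (hrow lam hl)
  have hsub : complementPartition n m '' P ⊆ partitionsOf n (n * m - r) := by
    rintro _ ⟨lam, hl, rfl⟩
    refine ⟨antitone_compl n m lam (hP hl).1, ?_⟩
    have h1 := sum_compl n m lam (hle lam hl)
    have h2 := (hP hl).2
    omega
  refine ⟨hsub, ?_⟩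
  rintro mu hmu _ ⟨lam, hl, rfl⟩ hdom
  have hT : ∀ i, complementPartition n m lam i ≤ m := fun i => Nat.sub_le _ _
  have hfil : Finset.univ.filter (fun i : Fin n => (i : ℕ) < 1) = {⟨0, hn⟩} := by
    ext i
    simp [Fin.ext_iff]
  have hmu0 : mu ⟨0, hn⟩ ≤ m := by
    have h := hdom 1
    rw [hfil, Finset.sum_singleton, Finset.sum_singleton] at h
    exact h.trans (hT _)
  have hmule : ∀ i, mu i ≤ m := fun i =>
    (hmu.1 (Fin.mk_le_of_le_val (Nat.zero_le _))).trans hmu0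
  refine ⟨complementPartition n m mu, ?_, compl_compl_eq n m mu hmule⟩
  have hsum := (hsub ⟨lam, hl, rfl⟩).2
  refine hsat _ ⟨antitone_compl n m mu hmu.1, ?_⟩ lam hl ?_
  · have h1 := sum_compl n m lam (hle lam hl)
    have h2 := (hP hl).2
    have h3 := sum_compl n m mu hmule
    have h4 := hmu.2
    omega
  · have h := dominates_compl n m _ mu hT hmule (hsum.trans hmu.2.symm) hdom
    rwa [compl_compl_eq n m lam (hle lam hl)] at h
end

section
/- Let k be a field, n and m positive integers, V = kⁿ the natural representation of the group GL_n(k), and α = (α₁ ≥ … ≥ α_m) a partition with 0 ≤ α_i ≤ n for all i. Then the k-linear map φ_α : ∧^{α₁}V ⊗ … ⊗ ∧^{α_m}V ⊗ ∧^{n−α_m}V ⊗ … ⊗ ∧^{n−α₁}V → (∧ⁿV)^{⊗m}, defined on basis elements by φ_α(v̂_S ⊗ v̂_{T̂}) = sgn(S)·δ_{S,T}·ω^{⊗m} for all column-strict fillings S, T of α, is a homomorphism of GL_n(k)-representations, where GL_n(k) acts diagonally on all tensor products and by the induced action (multiplication by the determinant) on each factor ∧ⁿV. -/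
open scoped TensorProduct

noncomputable section

lemma map_mem_exteriorPower {R : Type*} [CommRing R] {M N : Type*}
    [AddCommGroup M] [Module R M] [AddCommGroup N] [Module R N]
    (a : ℕ) (f : M →ₗ[R] N) {x : ExteriorAlgebra R M} (hx : x ∈ ⋀[R]^a M) :
    ExteriorAlgebra.map f x ∈ ⋀[R]^a N := by
  have h1 : x ∈ Submodule.span R (Set.range (ExteriorAlgebra.ιMulti R a (M := M))) := by
    rwa [ExteriorAlgebra.ιMulti_span_fixedDegree]
  have h2 : Submodule.map (ExteriorAlgebra.map f).toLinearMap
      (Submodule.span R (Set.range (ExteriorAlgebra.ιMulti R a (M := M)))) ≤ ⋀[R]^a N := by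
    rw [Submodule.map_span, Submodule.span_le]
    rintro y ⟨z, ⟨v, rfl⟩, rfl⟩
    simpa using ExteriorAlgebra.ιMulti_range R a (Set.mem_range_self (f ∘ v))
  exact h2 ⟨x, h1, rfl⟩

/-- The linear map `⋀[R]^a M →ₗ[R] ⋀[R]^a N` induced by a linear map `f : M →ₗ[R] N`
(the functorial action of the `a`-th exterior power). -/
def exteriorPowerMap {R : Type*} [CommRing R] {M N : Type*}
    [AddCommGroup M] [Module R M] [AddCommGroup N] [Module R N]
    (a : ℕ) (f : M →ₗ[R] N) : ⋀[R]^a M →ₗ[R] ⋀[R]^a N :=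
  LinearMap.restrict (ExteriorAlgebra.map f).toLinearMap
    (fun _ hx => map_mem_exteriorPower a f hx)

/-- The wedge product `v_{c 0} ∧ v_{c 1} ∧ … ∧ v_{c (a-1)}` of standard basis vectors of
`kⁿ`, as an element of the `a`-th exterior power `⋀[k]^a (kⁿ)`. -/
def wedgeVec (k : Type*) [Field k] (n a : ℕ) (c : Fin a → Fin n) : ⋀[k]^a (Fin n → k) :=
  ⟨ExteriorAlgebra.ιMulti k a (fun t => Pi.single (c t) (1 : k)),
    ExteriorAlgebra.ιMulti_range k a (Set.mem_range_self _)⟩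

/-- `ω = v_n ∧ v_{n-1} ∧ … ∧ v_1 ∈ ⋀[k]^n (kⁿ)`. -/
def omegaVec (k : Type*) [Field k] (n : ℕ) : ⋀[k]^n (Fin n → k) :=
  wedgeVec k n n (fun t => Fin.rev t)

/-- The strictly decreasing listing of the complement `{1,…,n} \ {entries of c}` of a
tuple `c` with entries in `Fin n`. -/
def complTuple (n a : ℕ) (c : Fin a → Fin n) : Fin (n - a) → Fin n :=
  fun ρ => (((Finset.univ \ Finset.image c Finset.univ).sort (· ≤ ·)).reverse).getD
    ρ.val ⟨0, by have := ρ.2; omega⟩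

lemma strictAnti_eq_of_range {n a : ℕ} {c d : Fin a → Fin n} (hc : StrictAnti c)
    (hd : StrictAnti d) (h : Set.range c = Set.range d) : c = d := by
  have hc' : StrictMono (c ∘ Fin.rev) := hc.comp Fin.rev_strictAnti
  have hd' : StrictMono (d ∘ Fin.rev) := hd.comp Fin.rev_strictAnti
  have : c ∘ Fin.rev = d ∘ Fin.rev := by
    apply (StrictMono.range_inj hc' hd').1
    rw [Fin.rev_surjective.range_comp, Fin.rev_surjective.range_comp, h]
  funext t
  simpa using congrFun this (Fin.rev t)

lemma complTuple_spec {n a : ℕ} (c : Fin a → Fin n) (hc : StrictAnti c) :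
    StrictAnti (complTuple n a c) ∧ ∀ x, x ∈ Set.range (complTuple n a c) ↔ x ∉ Set.range c := by
  set s : Finset (Fin n) := Finset.univ \ Finset.image c Finset.univ with hs
  have hcard : s.card = n - a := by
    rw [hs, Finset.card_sdiff_of_subset (Finset.subset_univ _),
      Finset.card_image_of_injective _ hc.injective]
    simp
  have hlen : ((s.sort (· ≤ ·)).reverse).length = n - a := by simp [hcard]
  have hget : ∀ r : Fin (n - a), complTuple n a c r =
      ((s.sort (· ≤ ·)).reverse)[r.val]'(by rw [hlen]; exact r.2) := by
    intro r
    unfold complTuple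
    rw [List.getD_eq_getElem]
  constructor
  · intro i j hij
    rw [hget, hget]
    have : ((s.sort (· ≤ ·)).reverse).Pairwise (· > ·) := by
      rw [List.pairwise_reverse]
      exact (Finset.sortedLT_sort s).pairwise
    exact List.pairwise_iff_getElem.1 this _ _ _ _ hij
  · intro x
    have h1 : x ∈ Set.range (complTuple n a c) ↔ x ∈ (s.sort (· ≤ ·)).reverse := by
      rw [List.mem_iff_getElem]
      constructor
      · rintro ⟨r, rfl⟩
        exact ⟨r.1, by rw [hlen]; exact r.2, (hget r).symm⟩
      · rintro ⟨i, hi, rfl⟩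
        exact ⟨⟨i, by rwa [hlen] at hi⟩, hget _⟩
    rw [h1]
    simp [hs]

lemma exists_complTuple {n a : ℕ} (ha : a ≤ n) (d : Fin (n - a) → Fin n) (hd : StrictAnti d) :
    ∃ c : Fin a → Fin n, StrictAnti c ∧ complTuple n a c = d := by
  set s : Finset (Fin n) := (Finset.image d Finset.univ)ᶜ with hs
  have hcard : s.card = a := by
    rw [hs, Finset.card_compl, Finset.card_image_of_injective _ hd.injective]
    simp
    omega
  have hc : StrictAnti (fun t => s.orderEmbOfFin hcard (Fin.rev t)) :=
    (s.orderEmbOfFin hcard).strictMono.comp_strictAnti Fin.rev_strictAnti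
  refine ⟨_, hc, strictAnti_eq_of_range (complTuple_spec _ hc).1 hd ?_⟩
  ext x
  rw [(complTuple_spec _ hc).2]
  have : Set.range (fun t => s.orderEmbOfFin hcard (Fin.rev t)) = s := by
    have := Fin.rev_surjective.range_comp (s.orderEmbOfFin hcard)
    rw [Finset.range_orderEmbOfFin] at this
    exact this
  rw [this]
  simp [hs]

/-- The basis of decreasing wedges. -/
def decBasis (k : Type*) [Field k] (n a : ℕ) :
    Module.Basis (Set.powersetCard (Fin n)ᵒᵈ a) k (⋀[k]^a (Fin n → k)) :=
  ((Pi.basisFun k (Fin n)).reindex OrderDual.toDual).exteriorPower a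

lemma decBasis_apply (k : Type*) [Field k] (n a : ℕ) (s : Set.powersetCard (Fin n)ᵒᵈ a) :
    ∃ c : Fin a → Fin n, StrictAnti c ∧ decBasis k n a s = wedgeVec k n a c := by
  refine ⟨fun t => OrderDual.ofDual (Set.powersetCard.ofFinEmbEquiv.symm s t), ?_, ?_⟩
  · intro i j h
    exact (Set.powersetCard.ofFinEmbEquiv.symm s).strictMono h
  · rw [decBasis, exteriorPower.basis_apply]
    apply Subtype.ext
    simp only [exteriorPower.ιMulti_family, exteriorPower.ιMulti_apply_coe, wedgeVec]
    congr 1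
    funext t
    simp

lemma wedge_mul_zero (k : Type*) [Field k] {n a : ℕ} (c d : Fin a → Fin n)
    (hc : StrictAnti c) (hd : StrictAnti d) (h : c ≠ d) :
    (wedgeVec k n a c : ExteriorAlgebra k (Fin n → k)) *
      (wedgeVec k n (n - a) (complTuple n a d) : ExteriorAlgebra k (Fin n → k)) = 0 := by
  have : ∃ t, c t ∉ Set.range d := by
    by_contra! hcon
    apply h
    apply strictAnti_eq_of_range hc hd
    have hsub : Finset.image c Finset.univ ⊆ Finset.image d Finset.univ := by
      intro x hx
      simp only [Finset.mem_image, Finset.mem_univ, true_and] at hx ⊢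
      obtain ⟨t, rfl⟩ := hx
      exact hcon t
    have := Finset.eq_of_subset_of_card_le hsub (by
      rw [Finset.card_image_of_injective _ hc.injective,
        Finset.card_image_of_injective _ hd.injective])
    simpa using congrArg (fun s : Finset (Fin n) => (s : Set (Fin n))) this
  obtain ⟨t, ht⟩ := this
  obtain ⟨r, hr⟩ := ((complTuple_spec d hd).2 _).2 ht
  simp only [wedgeVec, ExteriorAlgebra.ιMulti_mul_ιMulti]
  apply AlternatingMap.map_eq_zero_of_eq (i := Fin.castAdd (n - a) t) (j := Fin.natAdd a r)
  · simp [hr]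
  · apply ne_of_lt
    apply lt_of_lt_of_le (b := a) <;> simp

/-- Wedge product of exterior powers landing in total degree `n`. -/
def wedgeMul (k : Type*) [Field k] (n a b : ℕ) (h : a + b = n) :
    ⋀[k]^a (Fin n → k) →ₗ[k] ⋀[k]^b (Fin n → k) →ₗ[k] ⋀[k]^n (Fin n → k) :=
  LinearMap.mk₂ k (fun x y => ⟨(x : ExteriorAlgebra k (Fin n → k)) * y, by
      have := Submodule.mul_mem_mul x.2 y.2
      subst h
      rw [ExteriorAlgebra.exteriorPower, pow_add]
      exact this⟩)
    (fun _ _ _ => Subtype.ext (by simp [add_mul]))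
    (fun _ _ _ => Subtype.ext (by simp))
    (fun _ _ _ => Subtype.ext (by simp [mul_add]))
    (fun _ _ _ => Subtype.ext (by simp))

lemma wedgeMul_coe (k : Type*) [Field k] (n a b : ℕ) (h : a + b = n)
    (x : ⋀[k]^a (Fin n → k)) (y : ⋀[k]^b (Fin n → k)) :
    (wedgeMul k n a b h x y : ExteriorAlgebra k (Fin n → k)) = x * y := rfl

lemma wedgeMul_map (k : Type*) [Field k] (n a b : ℕ) (h : a + b = n)
    (f : (Fin n → k) →ₗ[k] (Fin n → k))
    (x : ⋀[k]^a (Fin n → k)) (y : ⋀[k]^b (Fin n → k)) :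
    wedgeMul k n a b h (exteriorPowerMap a f x) (exteriorPowerMap b f y) =
      exteriorPowerMap n f (wedgeMul k n a b h x y) := by
  apply Subtype.ext
  change ExteriorAlgebra.map f x * ExteriorAlgebra.map f y = ExteriorAlgebra.map f (x * y)
  rw [map_mul]

/-- The tuple of wedge products of matching factors. -/
def psiTuple (k : Type*) [Field k] (n m : ℕ) (α : Fin m → ℕ) (hαn : ∀ i, α i ≤ n)
    (x : (x : Fin m ⊕ Fin m) →
      ⋀[k]^(Sum.elim α (fun i => n - α (Fin.rev i)) x) (Fin n → k)) (i : Fin m) :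
    ⋀[k]^n (Fin n → k) :=
  wedgeMul k n (α i) (n - α (Fin.rev (Fin.rev i)))
    (by rw [Fin.rev_rev]; have := hαn i; omega) (x (Sum.inl i)) (x (Sum.inr (Fin.rev i)))

lemma psiTuple_inl (k : Type*) [Field k] (n m : ℕ) (α : Fin m → ℕ) (hαn : ∀ i, α i ≤ n)
    (x : (x : Fin m ⊕ Fin m) →
      ⋀[k]^(Sum.elim α (fun i => n - α (Fin.rev i)) x) (Fin n → k)) (i : Fin m)
    (y : ⋀[k]^(α i) (Fin n → k)) :
    psiTuple k n m α hαn (Function.update x (Sum.inl i) y) =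
      Function.update (psiTuple k n m α hαn x) i
        (wedgeMul k n (α i) (n - α (Fin.rev (Fin.rev i)))
          (by rw [Fin.rev_rev]; have := hαn i; omega) y (x (Sum.inr (Fin.rev i)))) := by
  funext j
  by_cases h : j = i
  · subst h
    rw [Function.update_self]
    exact congrArg₂ (fun a b => wedgeMul k n (α j) (n - α (Fin.rev (Fin.rev j)))
      (by rw [Fin.rev_rev]; have := hαn j; omega) a b)
      (Function.update_self _ _ _) (Function.update_of_ne (by simp) _ _)
  · rw [Function.update_of_ne h]
    exact congrArg₂ (fun a b => wedgeMul k n (α j) (n - α (Fin.rev (Fin.rev j)))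
      (by rw [Fin.rev_rev]; have := hαn j; omega) a b)
      (Function.update_of_ne (by simpa using h) _ _) (Function.update_of_ne (by simp) _ _)

lemma psiTuple_inr (k : Type*) [Field k] (n m : ℕ) (α : Fin m → ℕ) (hαn : ∀ i, α i ≤ n)
    (x : (x : Fin m ⊕ Fin m) →
      ⋀[k]^(Sum.elim α (fun i => n - α (Fin.rev i)) x) (Fin n → k)) (i : Fin m)
    (y : ⋀[k]^(n - α (Fin.rev (Fin.rev i))) (Fin n → k)) :
    psiTuple k n m α hαn (Function.update x (Sum.inr (Fin.rev i)) y) =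
      Function.update (psiTuple k n m α hαn x) i
        (wedgeMul k n (α i) (n - α (Fin.rev (Fin.rev i)))
          (by rw [Fin.rev_rev]; have := hαn i; omega) (x (Sum.inl i)) y) := by
  funext j
  by_cases h : j = i
  · subst h
    rw [Function.update_self]
    exact congrArg₂ (fun a b => wedgeMul k n (α j) (n - α (Fin.rev (Fin.rev j)))
      (by rw [Fin.rev_rev]; have := hαn j; omega) a b)
      (Function.update_of_ne (by simp) _ _) (Function.update_self _ _ _)
  · rw [Function.update_of_ne h]
    exact congrArg₂ (fun a b => wedgeMul k n (α j) (n - α (Fin.rev (Fin.rev j)))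
      (by rw [Fin.rev_rev]; have := hαn j; omega) a b)
      (Function.update_of_ne (by simp) _ _) (Function.update_of_ne (by simpa using h) _ _)

/-- The multilinear map underlying `φ_α`. -/
def psiMulti (k : Type*) [Field k] (n m : ℕ) (α : Fin m → ℕ) (hαn : ∀ i, α i ≤ n) :
    MultilinearMap k (fun x : Fin m ⊕ Fin m =>
      ⋀[k]^(Sum.elim α (fun i => n - α (Fin.rev i)) x) (Fin n → k))
      (⨂[k] (_ : Fin m), ⋀[k]^n (Fin n → k)) :=
  MultilinearMap.mk' (fun x => PiTensorProduct.tprod k (psiTuple k n m α hαn x))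
    (by
      intro x i y z
      rcases i with i | i
      · erw [psiTuple_inl, psiTuple_inl, psiTuple_inl, map_add, LinearMap.add_apply,
          MultilinearMap.map_update_add]
      · obtain ⟨i, rfl⟩ := Fin.rev_surjective i
        erw [psiTuple_inr, psiTuple_inr, psiTuple_inr, map_add,
          MultilinearMap.map_update_add])
    (by
      intro x i c y
      rcases i with i | i
      · erw [psiTuple_inl, psiTuple_inl, map_smul, LinearMap.smul_apply,
          MultilinearMap.map_update_smul]
      · obtain ⟨i, rfl⟩ := Fin.rev_surjective i
        erw [psiTuple_inr, psiTuple_inr, map_smul,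
          MultilinearMap.map_update_smul])

lemma psiMulti_apply (k : Type*) [Field k] (n m : ℕ) (α : Fin m → ℕ) (hαn : ∀ i, α i ≤ n)
    (x : (x : Fin m ⊕ Fin m) →
      ⋀[k]^(Sum.elim α (fun i => n - α (Fin.rev i)) x) (Fin n → k)) :
    psiMulti k n m α hαn x = PiTensorProduct.tprod k (psiTuple k n m α hαn x) := rfl

/-- The linear map `φ_α : ∧^{α₁}V ⊗ … ⊗ ∧^{α_m}V ⊗ ∧^{n−α_m}V ⊗ … ⊗ ∧^{n−α₁}V → (∧ⁿV)^{⊗m}`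
defined on basis vectors by `φ_α(v̂_S ⊗ v̂_{T̂}) = sgn(S)·δ_{S,T}·ω^{⊗m}` is a homomorphism
of `GL_n(k)`-representations.  Here `sgn` is (any) sign function satisfying the defining
equations `v̂_c ∧ v̂_ĉ = sgn(c)·ω` with `sgn(c) ∈ {±1}` for every strictly decreasing column
`c`; the first `m` tensor factors are indexed by `Sum.inl i` (with exterior degree `α i`)
and the last `m` factors by `Sum.inr i` (with exterior degree `n − α (rev i)`), so that the
factor `Sum.inr i` of `v̂_S ⊗ v̂_{T̂}` is the wedge of the basis vectors indexed by the
complement `T̂_i` of the column `T_{m+1-i}`; and `GL_n(k)` acts on each exterior power by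
the functorial map induced by its natural (matrix) action on `V = kⁿ`, hence on `∧ⁿV` by
multiplication with the determinant. -/
theorem phi_alpha_equivariant (k : Type*) [Field k] (n m : ℕ) (hn : 0 < n) (hm : 0 < m)
    (α : Fin m → ℕ) (hα : Antitone α) (hαn : ∀ i, α i ≤ n)
    (sgn : (a : ℕ) → (Fin a → Fin n) → ℤ)
    (hsgn : ∀ (a : ℕ), a ≤ n → ∀ c : Fin a → Fin n, StrictAnti c →
      (ExteriorAlgebra.ιMulti k a (fun t => (Pi.single (c t) (1 : k) : Fin n → k))) *
        (ExteriorAlgebra.ιMulti k (n - a)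
          (fun t => (Pi.single (complTuple n a c t) (1 : k) : Fin n → k))) =
        (sgn a c : ℤ) • (omegaVec k n : ExteriorAlgebra k (Fin n → k)) ∧
        (sgn a c = 1 ∨ sgn a c = -1))
    (φ : (⨂[k] (x : Fin m ⊕ Fin m),
            ⋀[k]^(Sum.elim α (fun i => n - α (Fin.rev i)) x) (Fin n → k)) →ₗ[k]
          ⨂[k] (_ : Fin m), ⋀[k]^n (Fin n → k))
    (hφ : ∀ (S T : (i : Fin m) → Fin (α i) → Fin n),
      (∀ i, StrictAnti (S i)) → (∀ i, StrictAnti (T i)) →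
      φ (PiTensorProduct.tprod k (fun x : Fin m ⊕ Fin m =>
          Sum.rec (motive := fun x =>
              ↥(⋀[k]^(Sum.elim α (fun i => n - α (Fin.rev i)) x) (Fin n → k)))
            (fun i => wedgeVec k n (α i) (S i))
            (fun i => wedgeVec k n (n - α (Fin.rev i))
              (complTuple n (α (Fin.rev i)) (T (Fin.rev i)))) x)) =
        (if S = T then ∏ i, sgn (α i) (S i) else 0) •
          PiTensorProduct.tprod k (fun _ : Fin m => omegaVec k n)) :
    ∀ g : GL (Fin n) k,
      (PiTensorProduct.map (fun _ : Fin m =>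
          exteriorPowerMap n (Matrix.toLin' (g : Matrix (Fin n) (Fin n) k)))) ∘ₗ φ =
      φ ∘ₗ (PiTensorProduct.map (fun x : Fin m ⊕ Fin m =>
          exteriorPowerMap (Sum.elim α (fun i => n - α (Fin.rev i)) x)
            (Matrix.toLin' (g : Matrix (Fin n) (Fin n) k)))) := by
  have hz : ∀ (z : ℤ) (t : ⨂[k] (_ : Fin m), ⋀[k]^n (Fin n → k)), z • t = (z : k) • t := by
    intro z t
    first
      | rfl
      | exact (Int.cast_smul_eq_zsmul k z t).symm
  have hlift : φ = PiTensorProduct.lift (psiMulti k n m α hαn) := by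
    apply PiTensorProduct.ext
    apply Module.Basis.ext_multilinear (fun x => decBasis k n _)
    intro v
    simp only [LinearMap.compMultilinearMap_apply, PiTensorProduct.lift.tprod, psiMulti_apply]
    generalize hx : (fun x => decBasis k n (Sum.elim α (fun i => n - α (Fin.rev i)) x) (v x)) = x
    have hS : ∀ i, ∃ c : Fin (α i) → Fin n, StrictAnti c ∧
        x (Sum.inl i) = wedgeVec k n (α i) c := by
      intro i
      subst hx
      exact decBasis_apply k n (α i) (v (Sum.inl i))
    have hT0 : ∀ i, ∃ c : Fin (α (Fin.rev i)) → Fin n, StrictAnti c ∧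
        x (Sum.inr i) = wedgeVec k n (n - α (Fin.rev i)) (complTuple n (α (Fin.rev i)) c) := by
      intro i
      subst hx
      obtain ⟨d, hd, hd'⟩ := decBasis_apply k n (n - α (Fin.rev i)) (v (Sum.inr i))
      obtain ⟨c, hc, rfl⟩ := exists_complTuple (hαn _) d hd
      exact ⟨c, hc, hd'⟩
    have hT : ∀ j, ∃ c : Fin (α j) → Fin n, StrictAnti c ∧ ∀ i, Fin.rev i = j →
        (x (Sum.inr i) : ExteriorAlgebra k (Fin n → k)) =
          wedgeVec k n (n - α j) (complTuple n (α j) c) := by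
      intro j
      obtain ⟨i, rfl⟩ := Fin.rev_surjective j
      obtain ⟨c, hc, h⟩ := hT0 i
      refine ⟨c, hc, fun i' hi' => ?_⟩
      obtain rfl := Fin.rev_injective hi'
      rw [h]
    choose S hSa hS using hS
    choose T hTa hT using hT
    have hxe : x = fun x : Fin m ⊕ Fin m =>
          Sum.rec (motive := fun x =>
              ↥(⋀[k]^(Sum.elim α (fun i => n - α (Fin.rev i)) x) (Fin n → k)))
            (fun i => wedgeVec k n (α i) (S i))
            (fun i => wedgeVec k n (n - α (Fin.rev i))
              (complTuple n (α (Fin.rev i)) (T (Fin.rev i)))) x := by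
      funext y
      rcases y with i | i
      · exact hS i
      · exact Subtype.ext (hT _ i rfl)
    have hcoe : ∀ i, (psiTuple k n m α hαn x i : ExteriorAlgebra k (Fin n → k)) =
        (wedgeVec k n (α i) (S i) : ExteriorAlgebra k (Fin n → k)) *
          wedgeVec k n (n - α i) (complTuple n (α i) (T i)) := by
      intro i
      rw [← hS i, ← hT i (Fin.rev i) (Fin.rev_rev i)]
      rfl
    have h1 := hφ S T hSa hTa
    rw [← hxe] at h1
    rw [h1]
    by_cases hST : S = T
    · subst hST
      rw [if_pos rfl]
      have : psiTuple k n m α hαn x = fun i => ((sgn (α i) (S i) : ℤ) : k) • omegaVec k n := by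
        funext i
        apply Subtype.ext
        rw [hcoe i]
        refine ((hsgn _ (hαn i) (S i) (hSa i)).1).trans ?_
        simp [Int.cast_smul_eq_zsmul]
      rw [this, MultilinearMap.map_smul_univ, ← Int.cast_prod, hz]
    · rw [if_neg hST, hz, Int.cast_zero, zero_smul]
      obtain ⟨i, hi⟩ := Function.ne_iff.1 hST
      symm
      apply MultilinearMap.map_coord_zero _ i
      apply Subtype.ext
      rw [hcoe i]
      exact wedge_mul_zero k _ _ (hSa i) (hTa i) hi
  intro g
  subst hlift
  apply PiTensorProduct.ext
  ext1 x
  simp only [LinearMap.compMultilinearMap_apply, LinearMap.comp_apply,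
    PiTensorProduct.lift.tprod, psiMulti_apply, PiTensorProduct.map_tprod]
  congr 1
  funext i
  exact (wedgeMul_map k n _ _ _ _ _ _).symm
end
end

section
/- Let k be an infinite field, n, r, m positive integers, and V = kⁿ the natural representation of GL_n(k). Let X be any set of partitions of r with at most m parts, each part at most n. Then there is an isomorphism of k-algebras End_{GL_n(k)}(⊕_{α∈X} ∧^αV) ≅ End_{GL_n(k)}(⊕_{α∈X} ∧^{n−α}V), where End_{GL_n(k)} denotes the algebra of GL_n(k)-equivariant linear endomorphisms. -/
open scoped TensorProduct DirectSum

noncomputable section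

/-- The direct sum `⊕_{α ∈ X} ∧^α V` of the tensor products of exterior powers
`∧^α V = ∧^{f α 1}V ⊗ … ⊗ ∧^{f α m}V`, for a set `X` of partitions and a shape function
`f` (which is either `α ↦ α` or `α ↦ n − α`). -/
abbrev sumOfWedges (k : Type*) [Field k] (n m : ℕ) (X : Set (Fin m → ℕ))
    (f : (Fin m → ℕ) → Fin m → ℕ) : Type _ :=
  ⨁ (α : X), ⨂[k] (i : Fin m), ⋀[k]^(f (α : Fin m → ℕ) i) (Fin n → k)

/-- The action of `g ∈ GL_n(k)` on `⊕_{α ∈ X} ∧^{f α} V`, acting functorially on each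
exterior power through its natural action on `V = kⁿ`, diagonally on tensor products and
componentwise on the direct sum. -/
def glAction (k : Type*) [Field k] (n m : ℕ) (X : Set (Fin m → ℕ))
    (f : (Fin m → ℕ) → Fin m → ℕ) (g : GL (Fin n) k) :
    Module.End k (sumOfWedges k n m X f) :=
  DirectSum.toModule k X _ (fun α =>
    (DirectSum.lof k X (fun α : X => ⨂[k] (i : Fin m), ⋀[k]^(f (α : Fin m → ℕ) i) (Fin n → k)) α) ∘ₗ
      PiTensorProduct.map (fun i : Fin m =>
        exteriorPowerMap (f (α : Fin m → ℕ) i) (Matrix.toLin' (g : Matrix (Fin n) (Fin n) k))))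

lemma exteriorPowerMap_eq_map {R : Type*} [CommRing R] {M N : Type*}
    [AddCommGroup M] [Module R M] [AddCommGroup N] [Module R N]
    (a : ℕ) (f : M →ₗ[R] N) : exteriorPowerMap a f = exteriorPower.map a f := by
  apply exteriorPower.linearMap_ext
  ext1 v
  rw [LinearMap.compAlternatingMap_apply, LinearMap.compAlternatingMap_apply,
    exteriorPower.map_apply_ιMulti]
  apply Subtype.ext
  exact ExteriorAlgebra.map_apply_ιMulti f v

/-- The functional on the exterior algebra reading off the coefficient of the volume form. -/
def volFun (k : Type*) [Field k] (n : ℕ) : ExteriorAlgebra k (Fin n → k) →ₗ[k] k :=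
  ExteriorAlgebra.liftAlternating (Pi.single n (Pi.basisFun k (Fin n)).det)

lemma volFun_map (k : Type*) [Field k] (n : ℕ) (f : (Fin n → k) →ₗ[k] (Fin n → k))
    (x : ExteriorAlgebra k (Fin n → k)) :
    volFun k n (ExteriorAlgebra.map f x) = LinearMap.det f * volFun k n x := by
  have : volFun k n ∘ₗ (ExteriorAlgebra.map f).toLinearMap = LinearMap.det f • volFun k n := by
    apply ExteriorAlgebra.lhom_ext
    intro i
    ext v
    simp only [LinearMap.compAlternatingMap_apply, LinearMap.comp_apply, AlgHom.toLinearMap_apply,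
      ExteriorAlgebra.map_apply_ιMulti, LinearMap.smul_apply, volFun,
      ExteriorAlgebra.liftAlternating_apply_ιMulti]
    by_cases h : i = n
    · subst h
      rw [Pi.single_eq_same, Module.Basis.det_comp, smul_eq_mul]
    · simp [Pi.single_eq_of_ne h]
  simpa using LinearMap.congr_fun this x

/-- The wedge pairing. -/
def wedgePair (k : Type*) [Field k] (n a b : ℕ) :
    ⋀[k]^b (Fin n → k) →ₗ[k] Module.Dual k (⋀[k]^a (Fin n → k)) :=
  LinearMap.mk₂ k (fun y x => volFun k n ((x : ExteriorAlgebra k (Fin n → k)) * y))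
    (by intros; simp [mul_add]) (by intros; simp) (by intros; simp [add_mul]) (by intros; simp)

lemma wedgePair_apply (k : Type*) [Field k] (n a b : ℕ) (y : ⋀[k]^b (Fin n → k))
    (x : ⋀[k]^a (Fin n → k)) : wedgePair k n a b y x =
      volFun k n ((x : ExteriorAlgebra k (Fin n → k)) * y) := rfl

lemma wedgePair_map (k : Type*) [Field k] (n a b : ℕ) (f : (Fin n → k) →ₗ[k] (Fin n → k))
    (y : ⋀[k]^b (Fin n → k)) (x : ⋀[k]^a (Fin n → k)) :
    wedgePair k n a b (exteriorPowerMap b f y) (exteriorPowerMap a f x) =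
      LinearMap.det f * wedgePair k n a b y x := by
  simp only [wedgePair_apply, ← volFun_map, map_mul]
  rfl

lemma volFun_top (k : Type*) [Field k] (n : ℕ) (s : Set.powersetCard (Fin n) n) :
    volFun k n (ExteriorAlgebra.ιMulti_family k n (Pi.basisFun k (Fin n)) s) ≠ 0 := by
  rw [ExteriorAlgebra.ιMulti_family, volFun, ExteriorAlgebra.liftAlternating_apply_ιMulti,
    Pi.single_eq_same]
  have hb : Function.Bijective (Set.powersetCard.ofFinEmbEquiv.symm s) :=
    Finite.injective_iff_bijective.mp (Set.powersetCard.ofFinEmbEquiv.symm s).injective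
  have := (Pi.basisFun k (Fin n)).isUnit_det
    ((Pi.basisFun k (Fin n)).reindex (Equiv.ofBijective _ hb).symm)
  simpa using this.ne_zero

lemma wedgePair_injective (k : Type*) [Field k] (n a b : ℕ) (h : a + b = n) :
    Function.Injective (wedgePair k n a b) := by
  subst h
  rw [← LinearMap.ker_eq_bot, LinearMap.ker_eq_bot']
  intro y hy
  set e := Pi.basisFun k (Fin (a + b)) with he
  apply (e.exteriorPower b).repr.injective
  ext t
  simp only [map_zero, Finsupp.coe_zero, Pi.zero_apply]
  let s : Set.powersetCard (Fin (a + b)) a := ⟨(t : Finset (Fin (a + b)))ᶜ, by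
    have := t.2
    rw [Set.powersetCard.mem_iff] at this ⊢
    rw [Finset.card_compl, this]; simp⟩
  have hst : Disjoint s.val t.val := disjoint_compl_left
  have h1 := LinearMap.congr_fun hy (exteriorPower.ιMulti_family k a e s)
  rw [wedgePair_apply, LinearMap.zero_apply, ← (e.exteriorPower b).sum_repr y] at h1
  simp only [AddSubmonoidClass.coe_finsetSum, Submodule.coe_smul, Finset.mul_sum, map_sum,
    mul_smul_comm, map_smul, exteriorPower.basis_apply,
    exteriorPower.ιMulti_family_apply_coe] at h1
  rw [Finset.sum_eq_single t, ExteriorAlgebra.ιMulti_family_mul_of_disjoint k e s t hst] at h1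
  · have := volFun_top k (a + b) (Set.powersetCard.disjUnion hst)
    rcases Int.units_eq_one_or (Set.powersetCard.permOfDisjoint hst).sign with hs | hs <;>
    · simp only [hs, one_smul, Units.neg_smul, map_neg, smul_neg, neg_eq_zero, smul_eq_mul,
        mul_eq_zero] at h1
      exact h1.resolve_right this
  · intro u _ hu
    rw [ExteriorAlgebra.ιMulti_family_mul_of_not_disjoint, map_zero, smul_zero]
    intro hd
    apply hu
    have hsub : u.val ≤ t.val := by
      have := hd.symm.le_compl_right
      simpa [s] using this
    apply Subtype.ext
    exact Finset.eq_of_subset_of_card_le hsub (by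
      have h2 := t.2
      have h3 := u.2
      rw [Set.powersetCard.mem_iff] at h2 h3
      rw [h2, h3])
  · simp

/-- The wedge pairing as an equivalence. -/
def wedgeEquiv (k : Type*) [Field k] (n a b : ℕ) (h : a + b = n) :
    ⋀[k]^b (Fin n → k) ≃ₗ[k] Module.Dual k (⋀[k]^a (Fin n → k)) :=
  LinearEquiv.ofInjectiveOfFinrankEq (wedgePair k n a b) (wedgePair_injective k n a b h) (by
    rw [Subspace.dual_finrank_eq, exteriorPower.finrank_eq, exteriorPower.finrank_eq,
      Module.finrank_fin_fun]
    exact Nat.choose_symm_of_eq_add (by omega))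

/-- The standard bilinear form on an exterior power, as an equivalence with the dual. -/
def dotEquiv (k : Type*) [Field k] (n a : ℕ) :
    ⋀[k]^a (Fin n → k) ≃ₗ[k] Module.Dual k (⋀[k]^a (Fin n → k)) :=
  ((Pi.basisFun k (Fin n)).exteriorPower a).toDualEquiv

lemma dotEquiv_eq (k : Type*) [Field k] (n a : ℕ) :
    (dotEquiv k n a : _ →ₗ[k] _) =
      exteriorPower.pairingDual k (Fin n → k) a ∘ₗ
        exteriorPower.map a (Pi.basisFun k (Fin n)).toDual := by
  apply ((Pi.basisFun k (Fin n)).exteriorPower a).ext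
  intro s
  have h := exteriorPower.basis_coord k a (Pi.basisFun k (Fin n)) s
  have hc : (Pi.basisFun k (Fin n)).toDual ∘ (Pi.basisFun k (Fin n)) =
      (Pi.basisFun k (Fin n)).coord := by
    ext1 i
    exact Module.Basis.coe_toDual_self _ i
  rw [exteriorPower.ιMultiDual, ← hc, ← exteriorPower.map_apply_ιMulti_family,
    ← exteriorPower.basis_apply] at h
  rw [LinearMap.comp_apply, ← h]
  exact Module.Basis.coe_toDual_self _ s

lemma dotEquiv_map (k : Type*) [Field k] (n a : ℕ) (A : Matrix (Fin n) (Fin n) k)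
    (x y : ⋀[k]^a (Fin n → k)) :
    dotEquiv k n a (exteriorPowerMap a (Matrix.toLin' A.transpose) x) y =
      dotEquiv k n a x (exteriorPowerMap a (Matrix.toLin' A) y) := by
  have key : (dotEquiv k n a : _ →ₗ[k] _) ∘ₗ exteriorPowerMap a (Matrix.toLin' A.transpose) =
      (LinearMap.lcomp k k (exteriorPowerMap a (Matrix.toLin' A))) ∘ₗ
        (dotEquiv k n a : _ →ₗ[k] _) := by
    rw [dotEquiv_eq, exteriorPowerMap_eq_map, exteriorPowerMap_eq_map]
    apply exteriorPower.linearMap_ext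
    ext1 v
    apply exteriorPower.linearMap_ext
    ext1 w
    simp only [LinearMap.compAlternatingMap_apply, LinearMap.comp_apply, LinearMap.lcomp_apply,
      exteriorPower.map_apply_ιMulti, exteriorPower.pairingDual_ιMulti_ιMulti]
    congr 1
    ext i j
    simp only [Matrix.of_apply, Function.comp_apply, Matrix.toLin'_apply]
    have hd : ∀ p q : Fin n → k, (Pi.basisFun k (Fin n)).toDual p q = p ⬝ᵥ q := by
      intro p q
      conv_lhs => rw [← (Pi.basisFun k (Fin n)).sum_repr q]
      simp only [map_sum, map_smul, Module.Basis.toDual_apply_left, dotProduct, smul_eq_mul,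
        Pi.basisFun_repr]
      exact Finset.sum_congr rfl fun _ _ => mul_comm _ _
    rw [hd, hd, Matrix.dotProduct_mulVec, Matrix.mulVec_transpose]
  exact LinearMap.congr_fun (LinearMap.congr_fun key x) y

/-- The Hodge star. -/
def star' (k : Type*) [Field k] (n a b : ℕ) (h : a + b = n) :
    ⋀[k]^a (Fin n → k) ≃ₗ[k] ⋀[k]^b (Fin n → k) :=
  (dotEquiv k n a).trans (wedgeEquiv k n a b h).symm

/-- The inverse transpose. -/
def invT {k : Type*} [Field k] {n : ℕ} (g : GL (Fin n) k) : GL (Fin n) k where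
  val := (g⁻¹ : GL (Fin n) k).val.transpose
  inv := g.val.transpose
  val_inv := by rw [← Matrix.transpose_mul, Units.mul_inv, Matrix.transpose_one]
  inv_val := by rw [← Matrix.transpose_mul, Units.inv_mul, Matrix.transpose_one]

lemma invT_invT {k : Type*} [Field k] {n : ℕ} (g : GL (Fin n) k) : invT (invT g) = g := by
  apply Units.ext
  change (g.val.transpose).transpose = g.val
  rw [Matrix.transpose_transpose]

lemma star'_equivariant (k : Type*) [Field k] (n a b : ℕ) (h : a + b = n) (g : GL (Fin n) k)
    (x : ⋀[k]^a (Fin n → k)) :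
    exteriorPowerMap b (Matrix.toLin' g.val) (star' k n a b h x) =
      g.val.det • star' k n a b h (exteriorPowerMap a (Matrix.toLin' (invT g).val) x) := by
  apply (wedgeEquiv k n a b h).injective
  rw [map_smul]
  simp only [star', LinearEquiv.trans_apply, LinearEquiv.apply_symm_apply]
  apply LinearMap.ext
  intro y'
  obtain ⟨y, rfl⟩ : ∃ y, exteriorPowerMap a (Matrix.toLin' g.val) y = y' := by
    refine ⟨exteriorPowerMap a (Matrix.toLin' (g⁻¹).val) y', ?_⟩
    rw [exteriorPowerMap_eq_map, exteriorPowerMap_eq_map, ← LinearMap.comp_apply,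
      ← exteriorPower.map_comp, ← Matrix.toLin'_mul, Units.mul_inv, Matrix.toLin'_one,
      exteriorPower.map_id]
    rfl
  have h1 : ∀ z, wedgeEquiv k n a b h z = wedgePair k n a b z := fun z => rfl
  rw [h1, wedgePair_map, ← h1, LinearEquiv.apply_symm_apply, LinearMap.det_toLin',
    LinearMap.smul_apply]
  congr 1
  change _ = dotEquiv k n a (exteriorPowerMap a (Matrix.toLin' (g⁻¹).val.transpose) x) _
  rw [dotEquiv_map, exteriorPowerMap_eq_map, exteriorPowerMap_eq_map,
      ← LinearMap.comp_apply (exteriorPower.map a _),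
      ← exteriorPower.map_comp, ← Matrix.toLin'_mul, Units.inv_mul, Matrix.toLin'_one,
      exteriorPower.map_id]
  rfl

/-- The tensor product of Hodge stars. -/
def tensorStar (k : Type*) [Field k] (n m : ℕ) (α : Fin m → ℕ) (hα : ∀ i, α i ≤ n) :
    (⨂[k] (i : Fin m), ⋀[k]^(α i) (Fin n → k)) ≃ₗ[k]
      ⨂[k] (i : Fin m), ⋀[k]^(n - α (Fin.rev i)) (Fin n → k) :=
  (PiTensorProduct.reindex k (fun i => ⋀[k]^(α i) (Fin n → k)) Fin.revPerm).trans
    (PiTensorProduct.congr (fun i => star' k n (α (Fin.rev i)) (n - α (Fin.rev i))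
      (Nat.add_sub_cancel' (hα _))))

lemma tensorStar_tprod (k : Type*) [Field k] (n m : ℕ) (α : Fin m → ℕ) (hα : ∀ i, α i ≤ n)
    (v : ∀ i, ⋀[k]^(α i) (Fin n → k)) :
    tensorStar k n m α hα (PiTensorProduct.tprod k v) =
      PiTensorProduct.tprod k (fun i => star' k n (α (Fin.rev i)) (n - α (Fin.rev i))
      (Nat.add_sub_cancel' (hα _)) (v (Fin.rev i))) := by
  rw [tensorStar, LinearEquiv.trans_apply, PiTensorProduct.reindex_tprod]
  exact PiTensorProduct.congr_tprod _ _

lemma tensorStar_equivariant (k : Type*) [Field k] (n m : ℕ) (α : Fin m → ℕ)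
    (hα : ∀ i, α i ≤ n) (g : GL (Fin n) k) (x : ⨂[k] (i : Fin m), ⋀[k]^(α i) (Fin n → k)) :
    PiTensorProduct.map (fun i : Fin m =>
        exteriorPowerMap (n - α (Fin.rev i)) (Matrix.toLin' g.val)) (tensorStar k n m α hα x) =
      g.val.det ^ m • tensorStar k n m α hα (PiTensorProduct.map (fun i : Fin m =>
        exteriorPowerMap (α i) (Matrix.toLin' (invT g).val)) x) := by
  have key : PiTensorProduct.map (fun i : Fin m =>
        exteriorPowerMap (n - α (Fin.rev i)) (Matrix.toLin' g.val)) ∘ₗ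
          (tensorStar k n m α hα : _ →ₗ[k] _) =
      g.val.det ^ m • ((tensorStar k n m α hα : _ →ₗ[k] _) ∘ₗ
        (PiTensorProduct.map (fun i : Fin m =>
          exteriorPowerMap (α i) (Matrix.toLin' (invT g).val)))) := by
    apply PiTensorProduct.ext
    ext1 v
    simp only [LinearMap.compMultilinearMap_apply, LinearMap.comp_apply, LinearMap.smul_apply,
      LinearEquiv.coe_coe, PiTensorProduct.map_tprod, tensorStar_tprod, star'_equivariant]
    rw [MultilinearMap.map_smul_univ]
    simp
  exact LinearMap.congr_fun key x

lemma centralizer_iso {k W W' G : Type*} [Field k] [AddCommMonoid W] [Module k W]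
    [AddCommMonoid W'] [Module k W'] (φ : W ≃ₗ[k] W')
    (ρ : G → Module.End k W) (ρ' : G → Module.End k W') (σ : G → G) (hσ : ∀ g, σ (σ g) = g)
    (c : G → k) (hc : ∀ g, c g ≠ 0)
    (hφ : ∀ g, ρ' g = c g • φ.conjAlgEquiv k (ρ (σ g))) :
    Nonempty (Subalgebra.centralizer k (Set.range ρ) ≃ₐ[k]
      Subalgebra.centralizer k (Set.range ρ')) := by
  have hmap : (Subalgebra.centralizer k (Set.range ρ)).map
      ((φ.conjAlgEquiv k : Module.End k W ≃ₐ[k] Module.End k W') :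
        Module.End k W →ₐ[k] Module.End k W') =
      Subalgebra.centralizer k (Set.range ρ') := by
    ext A
    rw [Subalgebra.mem_map, Subalgebra.mem_centralizer_iff]
    constructor
    · rintro ⟨B, hB, rfl⟩ _ ⟨g, rfl⟩
      rw [Subalgebra.mem_centralizer_iff] at hB
      have := congrArg (φ.conjAlgEquiv k) (hB _ ⟨σ g, rfl⟩)
      rw [map_mul, map_mul] at this
      rw [hφ, smul_mul_assoc, mul_smul_comm]
      exact congrArg _ this
    · intro hA
      refine ⟨(φ.conjAlgEquiv k).symm A, ?_, AlgEquiv.apply_symm_apply _ _⟩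
      rw [Subalgebra.mem_centralizer_iff]
      rintro _ ⟨g, rfl⟩
      apply (φ.conjAlgEquiv k).injective
      rw [map_mul, map_mul, AlgEquiv.apply_symm_apply]
      have := hA _ ⟨σ g, rfl⟩
      rw [hφ, hσ, smul_mul_assoc, mul_smul_comm] at this
      have h2 := congrArg (fun z => (c (σ g))⁻¹ • z) this
      simpa only [inv_smul_smul₀ (hc (σ g))] using h2
  exact ⟨((φ.conjAlgEquiv k).subalgebraMap _).trans (Subalgebra.equivOfEq _ _ hmap)⟩

/-- For any set `X` of partitions of `r` with at most `m` parts, each part at most `n`,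
the algebra of `GL_n(k)`-equivariant endomorphisms of `⊕_{α ∈ X} ∧^α V` is isomorphic, as
a `k`-algebra, to the algebra of `GL_n(k)`-equivariant endomorphisms of
`⊕_{α ∈ X} ∧^{n−α} V`.  Equivariant endomorphisms are exactly the elements of the
centralizer of the image of `GL_n(k)` in `Module.End`. -/
theorem equivariant_end_iso (k : Type*) [Field k] [Infinite k] (n r m : ℕ)
    (hn : 0 < n) (hr : 0 < r) (hm : 0 < m)
    (X : Set (Fin m → ℕ))
    (hX : ∀ α ∈ X, Antitone α ∧ (∀ i, α i ≤ n) ∧ ∑ i, α i = r) :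
    Nonempty (
      (Subalgebra.centralizer k
        (Set.range (glAction k n m X (fun α => α))) :
          Subalgebra k (Module.End k (sumOfWedges k n m X (fun α => α))))
      ≃ₐ[k]
      (Subalgebra.centralizer k
        (Set.range (glAction k n m X (fun α i => n - α (Fin.rev i)))) :
          Subalgebra k (Module.End k
            (sumOfWedges k n m X (fun α i => n - α (Fin.rev i)))))) := by
  let φ : sumOfWedges k n m X (fun α => α) ≃ₗ[k]
      sumOfWedges k n m X (fun α i => n - α (Fin.rev i)) :=
    DFinsupp.mapRange.linearEquiv (fun α : X => tensorStar k n m α.1 (hX α.1 α.2).2.1)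
  have hlof : ∀ (α : X) x, φ (DirectSum.lof k X _ α x) =
      DirectSum.lof k X (fun α : X => ⨂[k] (i : Fin m), ⋀[k]^(n - (α : Fin m → ℕ) (Fin.rev i))
        (Fin n → k)) α (tensorStar k n m α.1 (hX α.1 α.2).2.1 x) := by
    intro α x
    exact DFinsupp.mapRange_single (hf := fun i => map_zero _)
  have hφ : ∀ g : GL (Fin n) k, glAction k n m X (fun α i => n - α (Fin.rev i)) g =
      g.val.det ^ m • φ.conjAlgEquiv k (glAction k n m X (fun α => α) (invT g)) := by
    intro g
    have key : glAction k n m X (fun α i => n - α (Fin.rev i)) g ∘ₗ (φ : _ →ₗ[k] _) =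
      g.val.det ^ m • ((φ : _ →ₗ[k] _) ∘ₗ glAction k n m X (fun α => α) (invT g)) := by
      apply DirectSum.linearMap_ext
      intro α
      apply LinearMap.ext
      intro x
      simp only [LinearMap.comp_apply, LinearMap.smul_apply, LinearEquiv.coe_coe, hlof, glAction,
        DirectSum.toModule_lof]
      erw [tensorStar_equivariant k n m α.1 (hX α.1 α.2).2.1 g x]
      rw [map_smul]
    apply LinearMap.ext
    intro y
    obtain ⟨x, rfl⟩ := φ.surjective y
    have := LinearMap.congr_fun key x
    simpa [LinearEquiv.conjAlgEquiv_apply] using this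
  have hdet : ∀ g : GL (Fin n) k, g.val.det ^ m ≠ 0 := fun g =>
    pow_ne_zero _ ((Matrix.isUnit_iff_isUnit_det _).mp g.isUnit).ne_zero
  exact centralizer_iso φ (glAction k n m X (fun α => α)) (glAction k n m X (fun α i => n - α (Fin.rev i))) invT invT_invT (fun g => g.val.det ^ m) hdet hφ
end
end
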